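/- arXiv:2010.14975 — 2 statements merged into one kernel-verified Lean document; each statement's English description precedes it below -/
import Mathlib

section
/- Let m, n be natural numbers and 0 ≤ s ≤ min(m,n). Let A = (a,b) be a dominant stable B_{m|n}-datum, and let B = (a',b') ∈ ℚ^m × ℚ^n be any pair of vectors with B ≤ A. Assume that the truncated pair B' = ((a'_1,…,a'_{m−s}), (b'_1,…,b'_{n−s})) is a dominant B_{m−s|n−s}-datum and that A and B' have equal core. Then B' is stable. (This is Lemma 5.3 of the paper for g = osp(2m+1|2n) and x of rank s: the restriction ν|_{h_x} of a weight ν ≤ λ, with λ stable dominant, ν|_{h_x} dominant and core(λ) = core(ν|_{h_x}), is stable; truncation of the shifted coordinates models restriction to h_x.) -/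
/-!
Statement 2: Lemma 5.3 for `g = osp(2m+1|2n)` and `x` of rank `s`.
If `A` is a stable dominant `B_{m|n}`-datum, `B ≤ A`, and the truncation `B'`
is a dominant `B_{m-s|n-s}`-datum with the same core as `A`, then `B'` is stable.
-/

namespace GorelikHeidersdorfB

open Finset

/-- The ambient weight space `ℚ^m × ℚ^n`. -/
abbrev V (m n : ℕ) := (Fin m → ℚ) × (Fin n → ℚ)

/-- The basis vector `ε_i` (1-indexed); `0` when `i` is out of range. -/
def eps (m n : ℕ) (i : ℕ) : V m n :=
  (fun j => if (j : ℕ) + 1 = i then 1 else 0, 0)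

/-- The basis vector `δ_j` (1-indexed); `0` when `j` is out of range. -/
def delta (m n : ℕ) (j : ℕ) : V m n :=
  (0, fun k => if (k : ℕ) + 1 = j then 1 else 0)

/-- The sequence `u_1, …, u_{m+n}` for `osp(2m+1|2n)`: for `m ≥ n` it is
`ε_1, …, ε_{m-n+1}, δ_1, ε_{m-n+2}, δ_2, …, ε_m, δ_n`, and for `n > m` it is
`δ_1, …, δ_{n-m}, ε_1, δ_{n-m+1}, ε_2, …, ε_m, δ_n`. -/
def uB (m n : ℕ) (t : ℕ) : V m n :=
  if n ≤ m then
    if t ≤ m - n + 1 then eps m n t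
    else if (t - (m - n + 1)) % 2 = 1 then delta m n ((t - (m - n + 1) + 1) / 2)
    else eps m n (m - n + 1 + (t - (m - n + 1)) / 2)
  else
    if t ≤ n - m then delta m n t
    else if (t - (n - m)) % 2 = 1 then eps m n ((t - (n - m) + 1) / 2)
    else delta m n (n - m + (t - (n - m)) / 2)

/-- The simple roots `Σ` of `osp(2m+1|2n)`, indexed by `1 ≤ t ≤ m+n`:
for `t ≤ m+n-1` the root `u_t - u_{t+1}`, and for `t = m+n` the root `δ_n`. -/
def rootB (m n : ℕ) (t : ℕ) : V m n :=
  if t ≤ m + n - 1 then uB m n t - uB m n (t + 1) else delta m n n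

/-- `B ≤ A` : the difference `A - B` is a linear combination of elements of `Σ`
with non-negative integer coefficients. -/
def leB (m n : ℕ) (B A : V m n) : Prop :=
  ∃ c : ℕ → ℕ, A - B = ∑ t ∈ Finset.Icc 1 (m + n), (c t : ℚ) • rootB m n t

/-- `(a, b)` is a `B_{m|n}`-datum: every `a i + 1/2` and every `b j - 1/2` is a
non-negative integer. -/
def IsBDatum {m n : ℕ} (a : Fin m → ℚ) (b : Fin n → ℚ) : Prop :=
  (∀ i, ∃ k : ℕ, a i + 1/2 = k) ∧ (∀ j, ∃ k : ℕ, b j - 1/2 = k)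

/-- `mult_a(v) = #{i : |a_i| = v}`. -/
def multA {m : ℕ} (a : Fin m → ℚ) (v : ℚ) : ℕ :=
  (univ.filter fun i => |a i| = v).card

/-- `mult_b(v) = #{j : b_j = v}`. -/
def multB {n : ℕ} (b : Fin n → ℚ) (v : ℚ) : ℕ :=
  (univ.filter fun j => b j = v).card

/-- Dominance for a `B_{m|n}`-datum. -/
def BDominant {m n : ℕ} (a : Fin m → ℚ) (b : Fin n → ℚ) : Prop :=
  (∀ i j : Fin m, i ≤ j → a j ≤ a i) ∧
  (∀ i j : Fin m, i < j → a i = a j → a i = -(1/2)) ∧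
  (∀ i j : Fin n, i ≤ j → b j ≤ b i) ∧
  (∀ i j : Fin n, i < j → b i = b j → b i = 1/2) ∧
  (multA a (1/2) ≤ multB b (1/2) + 1 ∧ multB b (1/2) ≤ multA a (1/2) + 1)

/-- `v` is a `×`-value. -/
def IsCrossValue {m n : ℕ} (a : Fin m → ℚ) (b : Fin n → ℚ) (v : ℚ) : Prop :=
  1 ≤ min (multA a v) (multB b v)

/-- `v` is a `>`-value. -/
def IsGtValue {m n : ℕ} (a : Fin m → ℚ) (b : Fin n → ℚ) (v : ℚ) : Prop :=
  multB b v < multA a v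

/-- `v` is a `<`-value. -/
def IsLtValue {m n : ℕ} (a : Fin m → ℚ) (b : Fin n → ℚ) (v : ℚ) : Prop :=
  multA a v < multB b v

/-- `v` is a core value. -/
def IsCoreValue {m n : ℕ} (a : Fin m → ℚ) (b : Fin n → ℚ) (v : ℚ) : Prop :=
  IsGtValue a b v ∨ IsLtValue a b v

/-- Two data have equal core: the same `>`-values and the same `<`-values. -/
def EqualCore {m n m' n' : ℕ} (a : Fin m → ℚ) (b : Fin n → ℚ)
    (a' : Fin m' → ℚ) (b' : Fin n' → ℚ) : Prop :=
  (∀ v, IsGtValue a b v ↔ IsGtValue a' b' v) ∧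
  (∀ v, IsLtValue a b v ↔ IsLtValue a' b' v)

/-- Stability: every `×`-value is strictly smaller than every core value. -/
def BStable {m n : ℕ} (a : Fin m → ℚ) (b : Fin n → ℚ) : Prop :=
  ∀ v w, IsCrossValue a b v → IsCoreValue a b w → v < w


/-- The sum of the first `P` coordinates of the `ε`-part and the first `Q` coordinates of the
`δ`-part. -/
def partialSum (m n P Q : ℕ) : V m n →ₗ[ℚ] ℚ where
  toFun X := (∑ i : Fin m, if (i : ℕ) < P then X.1 i else 0) +
    ∑ j : Fin n, if (j : ℕ) < Q then X.2 j else 0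
  map_add' X Y := by
    simp only [Prod.fst_add, Prod.snd_add, Pi.add_apply, ← Finset.sum_filter,
      Finset.sum_add_distrib]
    ring
  map_smul' r X := by
    simp only [Prod.smul_fst, Prod.smul_snd, Pi.smul_apply, smul_eq_mul, ← Finset.sum_filter,
      ← Finset.mul_sum, RingHom.id_apply]
    ring

lemma partialSum_apply {m n P Q : ℕ} (X : V m n) :
    partialSum m n P Q X = (∑ i : Fin m, if (i : ℕ) < P then X.1 i else 0) +
      ∑ j : Fin n, if (j : ℕ) < Q then X.2 j else 0 := rfl

lemma sum_ite_lt_ite_succ_eq {m P : ℕ} (hP : P ≤ m) (i : ℕ) :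
    (∑ j : Fin m, if (j : ℕ) < P then (if (j : ℕ) + 1 = i then (1 : ℚ) else 0) else 0) =
      if 1 ≤ i ∧ i ≤ P then 1 else 0 := by
  split_ifs with h
  · rw [Finset.sum_eq_single (⟨i - 1, by omega⟩ : Fin m)]
    · rw [if_pos (by simp only; omega), if_pos (by simp only; omega)]
    · intro j _ hj
      have : (j : ℕ) + 1 ≠ i := fun hji => hj (Fin.ext (by simp only; omega))
      simp [this]
    · simp
  · refine Finset.sum_eq_zero fun j _ => ?_
    split_ifs <;> first | rfl | omega

lemma partialSum_eps {m n P Q : ℕ} (hP : P ≤ m) (i : ℕ) :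
    partialSum m n P Q (eps m n i) = if 1 ≤ i ∧ i ≤ P then 1 else 0 := by
  simpa [partialSum_apply, eps] using sum_ite_lt_ite_succ_eq hP i

lemma partialSum_delta {m n P Q : ℕ} (hQ : Q ≤ n) (j : ℕ) :
    partialSum m n P Q (delta m n j) = if 1 ≤ j ∧ j ≤ Q then 1 else 0 := by
  simpa [partialSum_apply, delta] using sum_ite_lt_ite_succ_eq hQ j

/-- If `ε_1, …, ε_P, δ_1, …, δ_Q` form an initial segment of the sequence `u`, then
`partialSum` is non-negative on simple roots. -/
lemma partialSum_rootB_nonneg {m n P Q : ℕ} (hP : P ≤ m) (hQ : Q ≤ n)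
    (h₁ : 1 ≤ P → Q < n → P + n ≤ Q + 1 + m) (h₂ : 1 ≤ Q → P < m → Q + m < P + 1 + n)
    {t : ℕ} (ht : 1 ≤ t) : 0 ≤ partialSum m n P Q (rootB m n t) := by
  unfold rootB
  split_ifs with htmn
  · rw [map_sub, sub_nonneg]
    unfold uB
    split_ifs <;> simp only [partialSum_eps hP, partialSum_delta hQ] <;> split_ifs <;>
      first | (norm_num; done) | (exfalso; omega)
  · rw [partialSum_delta hQ]
    split_ifs <;> norm_num

lemma partialSum_nonneg_of_leB {m n P Q : ℕ} {A B : V m n} (h : leB m n B A)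
    (hP : P ≤ m) (hQ : Q ≤ n)
    (h₁ : 1 ≤ P → Q < n → P + n ≤ Q + 1 + m) (h₂ : 1 ≤ Q → P < m → Q + m < P + 1 + n) :
    0 ≤ partialSum m n P Q (A - B) := by
  obtain ⟨c, hc⟩ := h
  rw [hc, map_sum]
  refine Finset.sum_nonneg fun t ht => ?_
  rw [map_smul, smul_eq_mul]
  exact mul_nonneg (Nat.cast_nonneg _)
    (partialSum_rootB_nonneg hP hQ h₁ h₂ (Finset.mem_Icc.1 ht).1)

/-- `A` and `B` cannot agree before positions `p`, `q` while `A` is smaller than `B` in both of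
these positions. -/
lemma not_leB_of_lt {m n : ℕ} {A B : V m n} (p : Fin m) (q : Fin n)
    (hp : ∀ i < p, A.1 i = B.1 i) (hq : ∀ j < q, A.2 j = B.2 j)
    (hp' : A.1 p < B.1 p) (hq' : A.2 q < B.2 q) : ¬ leB m n B A := by
  intro h
  have hpm := p.isLt
  have hqn := q.isLt
  rcases le_or_gt ((p : ℕ) + n) (q + m) with hpq | hpq
  · have := partialSum_nonneg_of_leB (P := p + 1) (Q := p + n - m) h (by omega) (by omega)
      (by omega) (by omega)
    have h₁ : (∑ i : Fin m, if (i : ℕ) < p + 1 then (A - B).1 i else 0) = (A - B).1 p := by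
      rw [Finset.sum_eq_single p]
      · simp
      · intro i _ hi
        split_ifs with hip
        · simp [hp i (lt_of_le_of_ne (Fin.le_def.2 (by omega)) hi)]
        · rfl
      · simp
    have h₂ : (∑ j : Fin n, if (j : ℕ) < p + n - m then (A - B).2 j else 0) = 0 := by
      refine Finset.sum_eq_zero fun j _ => ?_
      split_ifs with hjq
      · simp [hq j (Fin.lt_def.2 (by omega))]
      · rfl
    rw [partialSum_apply, h₁, h₂, Prod.fst_sub, Pi.sub_apply] at this
    linarith
  · have := partialSum_nonneg_of_leB (P := q + 1 + m - n) (Q := q + 1) h (by omega) (by omega)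
      (by omega) (by omega)
    have h₁ : (∑ i : Fin m, if (i : ℕ) < q + 1 + m - n then (A - B).1 i else 0) = 0 := by
      refine Finset.sum_eq_zero fun i _ => ?_
      split_ifs with hip
      · simp [hp i (Fin.lt_def.2 (by omega))]
      · rfl
    have h₂ : (∑ j : Fin n, if (j : ℕ) < q + 1 then (A - B).2 j else 0) = (A - B).2 q := by
      rw [Finset.sum_eq_single q]
      · simp
      · intro j _ hj
        split_ifs with hjq
        · simp [hq j (lt_of_le_of_ne (Fin.le_def.2 (by omega)) hj)]
        · rfl
      · simp
    rw [partialSum_apply, h₁, h₂, Prod.snd_sub, Pi.sub_apply] at this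
    linarith

/-- Two decreasing sequences with the same entries above `x`, each occurring once, agree up to
the position where `x` occurs in the second one, provided `x` does not occur in the first. -/
lemma agree_before_and_lt {m k : ℕ} (hk : k ≤ m) {a : Fin m → ℚ} {c : Fin k → ℚ} {x : ℚ}
    (ha : ∀ i j, i ≤ j → a j ≤ a i) (ha' : ∀ i j, i < j → a i = a j → a i ≤ x)
    (hc : ∀ i j, i ≤ j → c j ≤ c i) (hc' : ∀ i j, i < j → c i = c j → c i < x)
    (hac : ∀ v, x < v → ((∃ i, a i = v) ↔ ∃ i, c i = v)) (hax : ∀ i, a i ≠ x)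
    (p : Fin k) (hp : c p = x) :
    (∀ i < p, a (Fin.castLE hk i) = c i) ∧ a (Fin.castLE hk p) < x := by
  have hgt : ∀ i < p, x < c i := fun i hi => by
    refine lt_of_le_of_ne (hp ▸ hc i p hi.le) fun h => ?_
    exact absurd (hc' i p hi (by rw [hp, h])) (by rw [← h]; exact lt_irrefl _)
  have hlt : ∀ i, x < c i → i < p := fun i hi => by
    by_contra! h
    exact absurd (hc p i h) (by rw [hp]; exact not_le.2 hi)
  have main : ∀ (N : ℕ) (i : Fin k), (i : ℕ) = N → i < p → a (Fin.castLE hk i) = c i := by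
    intro N
    induction N using Nat.strong_induction_on with
    | _ N ih =>
      rintro i rfl hi
      obtain ⟨j, hj⟩ := (hac _ (hgt i hi)).2 ⟨i, rfl⟩
      have hij : Fin.castLE hk i ≤ j := by
        by_contra! hji
        have hji' : (j : ℕ) < i := hji
        have hjk : (j : ℕ) < k := hji'.trans i.isLt
        have hlt' : (⟨j, hjk⟩ : Fin k) < i := hji'
        have := ih j hji' ⟨j, hjk⟩ rfl (hlt'.trans hi)
        have h1 := hc' ⟨j, hjk⟩ i hlt' (by rw [← this, ← hj]; rfl)
        exact absurd (hgt _ (hlt'.trans hi)) (not_lt.2 h1.le)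
      have hge : c i ≤ a (Fin.castLE hk i) := hj ▸ ha _ _ hij
      obtain ⟨l, hl⟩ := (hac _ ((hgt i hi).trans_le hge)).1 ⟨_, rfl⟩
      have hil : i ≤ l := by
        by_contra! hli
        have := ih l hli l rfl (hli.trans hi)
        have h1 := ha' (Fin.castLE hk l) (Fin.castLE hk i) hli (by rw [this, hl])
        rw [this] at h1
        exact absurd (hgt _ (hli.trans hi)) (not_lt.2 h1)
      exact le_antisymm (hl ▸ hc _ _ hil) hge
  refine ⟨fun i hi => main i i rfl hi, ?_⟩
  by_contra! h
  have hx : x < a (Fin.castLE hk p) := lt_of_le_of_ne h (hax _).symm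
  obtain ⟨l, hl⟩ := (hac _ hx).1 ⟨_, rfl⟩
  have hlp : l < p := hlt l (hl ▸ hx)
  have h1 := ha' (Fin.castLE hk l) (Fin.castLE hk p) hlp (by rw [main l l rfl hlp, hl])
  rw [main l l rfl hlp] at h1
  exact absurd (hgt l hlp) (not_lt.2 h1)

lemma multA_pos_iff {m : ℕ} {a : Fin m → ℚ} {v : ℚ} : 0 < multA a v ↔ ∃ i, |a i| = v := by
  simp [multA, Finset.card_pos, Finset.Nonempty]

lemma multB_pos_iff {n : ℕ} {b : Fin n → ℚ} {v : ℚ} : 0 < multB b v ↔ ∃ j, b j = v := by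
  simp [multB, Finset.card_pos, Finset.Nonempty]

lemma sum_multA {m : ℕ} (a : Fin m → ℚ) {S : Finset ℚ} (hS : ∀ i, |a i| ∈ S) :
    ∑ v ∈ S, multA a v = m := by
  simpa [multA] using (Finset.card_eq_sum_card_fiberwise (s := univ) (t := S)
    (f := fun i => |a i|) (fun i _ => hS i)).symm

/-- If every multiplicity in `a` is at most that in `c`, with one strict inequality, then `c` is
longer than `a`. -/
lemma lt_of_multA_le {m k : ℕ} {a : Fin m → ℚ} {c : Fin k → ℚ}
    (h : ∀ v, multA a v ≤ multA c v) {w : ℚ} (hw : multA a w < multA c w) : m < k := by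
  let S : Finset ℚ := univ.image (fun i => |a i|) ∪ univ.image (fun i => |c i|)
  have hSc : ∀ i, |c i| ∈ S := fun i => by simp [S]
  obtain ⟨i, rfl⟩ := multA_pos_iff.1 (Nat.zero_lt_of_lt hw)
  rw [← sum_multA a (S := S) (fun i => by simp [S]), ← sum_multA c hSc]
  exact Finset.sum_lt_sum (fun v _ => h v) ⟨_, hSc i, hw⟩

section Datum

variable {m n : ℕ} {a : Fin m → ℚ} {b : Fin n → ℚ} {v : ℚ}

lemma IsBDatum.neg_half_le (h : IsBDatum a b) (i : Fin m) : -(1/2) ≤ a i := by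
  obtain ⟨k, hk⟩ := h.1 i
  have : (0 : ℚ) ≤ k := Nat.cast_nonneg k
  linarith

lemma IsBDatum.half_le (h : IsBDatum a b) (j : Fin n) : 1/2 ≤ b j := by
  obtain ⟨k, hk⟩ := h.2 j
  have : (0 : ℚ) ≤ k := Nat.cast_nonneg k
  linarith

lemma IsBDatum.half_le_abs (h : IsBDatum a b) (i : Fin m) : 1/2 ≤ |a i| := by
  obtain ⟨k, hk⟩ := h.1 i
  rcases Nat.eq_zero_or_pos k with rfl | hk0
  · rw [le_abs]; right; push_cast at hk; linarith
  · have : (1 : ℚ) ≤ k := by exact_mod_cast hk0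
    rw [le_abs]; left; linarith

lemma IsBDatum.abs_eq_iff (h : IsBDatum a b) (hv : 1/2 < v) (i : Fin m) :
    |a i| = v ↔ a i = v := by
  have := h.neg_half_le i
  constructor
  · intro hi
    rcases abs_choice (a i) with h' | h' <;> linarith
  · rintro rfl
    exact abs_of_pos (by linarith)

lemma IsBDatum.multA_pos_iff (h : IsBDatum a b) (hv : 1/2 < v) :
    0 < multA a v ↔ ∃ i, a i = v := by
  simp only [GorelikHeidersdorfB.multA_pos_iff, h.abs_eq_iff hv]

lemma IsBDatum.half_le_of_core (h : IsBDatum a b) (hv : IsCoreValue a b v) : 1/2 ≤ v := by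
  rcases hv with hv | hv
  · obtain ⟨i, rfl⟩ := GorelikHeidersdorfB.multA_pos_iff.1 (Nat.zero_lt_of_lt hv)
    exact h.half_le_abs i
  · obtain ⟨j, rfl⟩ := multB_pos_iff.1 (Nat.zero_lt_of_lt hv)
    exact h.half_le j

lemma BDominant.multA_le_one (h : BDominant a b) (hd : IsBDatum a b) (hv : 1/2 < v) :
    multA a v ≤ 1 := by
  refine Finset.card_le_one.2 fun i hi j hj => ?_
  simp only [mem_filter, mem_univ, true_and, hd.abs_eq_iff hv] at hi hj
  by_contra hij
  rcases lt_or_gt_of_ne hij with hij | hij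
  · have := h.2.1 i j hij (by rw [hi, hj]); linarith
  · have := h.2.1 j i hij (by rw [hi, hj]); linarith

lemma BDominant.multB_le_one (h : BDominant a b) (hv : 1/2 < v) : multB b v ≤ 1 := by
  refine Finset.card_le_one.2 fun i hi j hj => ?_
  simp only [mem_filter, mem_univ, true_and] at hi hj
  by_contra hij
  rcases lt_or_gt_of_ne hij with hij | hij
  · have := h.2.2.2.1 i j hij (by rw [hi, hj]); linarith
  · have := h.2.2.2.1 j i hij (by rw [hi, hj]); linarith

lemma BDominant.multA_le_multB_add_one (h : BDominant a b) (hd : IsBDatum a b) (v : ℚ) :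
    multA a v ≤ multB b v + 1 := by
  rcases lt_trichotomy v (1/2) with hv | rfl | hv
  · have : ¬ 0 < multA a v := fun hpos => by
      obtain ⟨i, rfl⟩ := GorelikHeidersdorfB.multA_pos_iff.1 hpos
      exact absurd (hd.half_le_abs i) (not_le.2 hv)
    omega
  · exact h.2.2.2.2.1
  · have := h.multA_le_one hd hv
    omega

lemma BDominant.not_core_of_cross (h : BDominant a b) (hd : IsBDatum a b) (hv : 1/2 < v)
    (hx : IsCrossValue a b v) : ¬ IsCoreValue a b v := by
  have h1 := h.multA_le_one hd hv
  have h2 := h.multB_le_one hv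
  unfold IsCrossValue at hx
  unfold IsCoreValue IsGtValue IsLtValue
  omega

end Datum

section EqualCore

variable {m n k l : ℕ} {a : Fin m → ℚ} {b : Fin n → ℚ} {c : Fin k → ℚ} {d : Fin l → ℚ}

lemma EqualCore.isCoreValue_iff (h : EqualCore a b c d) (v : ℚ) :
    IsCoreValue a b v ↔ IsCoreValue c d v := or_congr (h.1 v) (h.2 v)

lemma EqualCore.mult_pos_iff (h : EqualCore a b c d) {v : ℚ} (hv : ¬ IsCrossValue a b v)
    (hv' : ¬ IsCrossValue c d v) :
    (0 < multA a v ↔ 0 < multA c v) ∧ (0 < multB b v ↔ 0 < multB d v) := by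
  have h1 := h.1 v
  have h2 := h.2 v
  unfold IsCrossValue at hv hv'
  unfold IsGtValue at h1
  unfold IsLtValue at h2
  omega

end EqualCore

/-- If a shorter dominant datum has the same core as a stable one, no `×`-value of it is a core
value. -/
lemma EqualCore.not_core_of_cross {m n k l : ℕ} (hk : k ≤ m) {a : Fin m → ℚ} {b : Fin n → ℚ}
    {c : Fin k → ℚ} {d : Fin l → ℚ} (h : EqualCore a b c d)
    (hab : IsBDatum a b) (hdom : BDominant a b) (hst : BStable a b)
    (hcd : IsBDatum c d) (hdom' : BDominant c d) {v : ℚ} (hx : IsCrossValue c d v) :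
    ¬ IsCoreValue c d v := by
  intro hv
  have hvhalf : v = 1/2 := by
    refine le_antisymm (not_lt.1 fun hlt => hdom'.not_core_of_cross hcd hlt hx hv)
      (hcd.half_le_of_core hv)
  have hncross : ∀ w, ¬ IsCrossValue a b w := fun w hw => by
    have hlt := hst w v hw ((h.isCoreValue_iff v).2 hv)
    have hpos : 0 < multB b w := by unfold IsCrossValue at hw; omega
    obtain ⟨j, rfl⟩ := multB_pos_iff.1 hpos
    have := hab.half_le j
    linarith
  have hle : ∀ w, multA a w ≤ multA c w := fun w => by
    have h1 := hncross w
    have h2 := hdom.multA_le_multB_add_one hab w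
    have h3 := (h.1 w).1
    unfold IsCrossValue at h1
    unfold IsGtValue at h3
    omega
  refine absurd (lt_of_multA_le hle (w := v) ?_) (not_lt.2 hk)
  have h1 := hncross v
  have h2 := hdom.multA_le_multB_add_one hab v
  have h3 := (h.1 v).1
  unfold IsCrossValue at h1 hx
  unfold IsGtValue at h3
  omega

/-- **Lemma 5.3** for `osp(2m+1|2n)` and `x` of rank `s`: if `λ` is stable dominant,
`ν ≤ λ`, the restriction `ν|_{h_x}` (modelled by truncating the shifted coordinates)
is dominant and has the same core as `λ`, then `ν|_{h_x}` is stable. -/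
theorem BStable_of_truncation (m n s : ℕ) (hs : s ≤ min m n)
    (a a' : Fin m → ℚ) (b b' : Fin n → ℚ)
    (hAdatum : IsBDatum a b) (hAdom : BDominant a b) (hAstable : BStable a b)
    (hle : leB m n (a', b') (a, b))
    (hB'datum : IsBDatum (fun i : Fin (m - s) => a' (Fin.castLE (Nat.sub_le m s) i))
      (fun j : Fin (n - s) => b' (Fin.castLE (Nat.sub_le n s) j)))
    (hB'dom : BDominant (fun i : Fin (m - s) => a' (Fin.castLE (Nat.sub_le m s) i))
      (fun j : Fin (n - s) => b' (Fin.castLE (Nat.sub_le n s) j)))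
    (hcore : EqualCore a b (fun i : Fin (m - s) => a' (Fin.castLE (Nat.sub_le m s) i))
      (fun j : Fin (n - s) => b' (Fin.castLE (Nat.sub_le n s) j))) :
    BStable (fun i : Fin (m - s) => a' (Fin.castLE (Nat.sub_le m s) i))
      (fun j : Fin (n - s) => b' (Fin.castLE (Nat.sub_le n s) j)) := by
  set c := fun i : Fin (m - s) => a' (Fin.castLE (Nat.sub_le m s) i)
  set d := fun j : Fin (n - s) => b' (Fin.castLE (Nat.sub_le n s) j)
  intro y w hy hw
  by_contra! hwy
  have hwy' : w < y := lt_of_le_of_ne hwy fun hEq =>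
    hcore.not_core_of_cross (Nat.sub_le m s) hAdatum hAdom hAstable hB'datum hB'dom hy (hEq ▸ hw)
  obtain ⟨x, hx, hwx, hmax⟩ : ∃ x, IsCrossValue c d x ∧ w < x ∧
      ∀ v, x < v → ¬ IsCrossValue c d v := by
    classical
    have hmem : ∀ v, IsCrossValue c d v → ∃ j, d j = v := fun v hv =>
      multB_pos_iff.1 (by unfold IsCrossValue at hv; omega)
    obtain ⟨j₀, rfl⟩ := hmem y hy
    obtain ⟨j, hj, hjmax⟩ := Finset.exists_max_image
      (univ.filter fun j => IsCrossValue c d (d j)) d ⟨j₀, by simpa using hy⟩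
    simp only [mem_filter, mem_univ, true_and] at hj hjmax
    refine ⟨d j, hj, hwy'.trans_le (hjmax j₀ hy), fun v hv hcv => ?_⟩
    obtain ⟨l, rfl⟩ := hmem v hcv
    exact absurd (hjmax l hcv) (not_le.2 hv)
  have hwA : IsCoreValue a b w := (hcore.isCoreValue_iff w).2 hw
  have hx2 : 1/2 < x := (hAdatum.half_le_of_core hwA).trans_lt hwx
  have hncross : ∀ v, x ≤ v → ¬ IsCrossValue a b v := fun v hv hcv =>
    absurd (hAstable v w hcv hwA) (not_lt.2 (hwx.le.trans hv))
  have hxcore : ¬ IsCoreValue a b x := fun h =>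
    hB'dom.not_core_of_cross hB'datum hx2 hx ((hcore.isCoreValue_iff x).1 h)
  have hx0 : ¬ 0 < multA a x ∧ ¬ 0 < multB b x := by
    have := hncross x le_rfl
    unfold IsCrossValue at this
    unfold IsCoreValue IsGtValue IsLtValue at hxcore
    omega
  have hx1 : 0 < multA c x ∧ 0 < multB d x := by
    unfold IsCrossValue at hx
    omega
  obtain ⟨p, hp⟩ := (hB'datum.multA_pos_iff hx2).1 hx1.1
  obtain ⟨q, hq⟩ := multB_pos_iff.1 hx1.2
  have hmult := fun v (hv : x < v) => hcore.mult_pos_iff (hncross v hv.le) (hmax v hv)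
  obtain ⟨hpa, hpx⟩ := agree_before_and_lt (Nat.sub_le m s) hAdom.1
    (fun i j hij h => by have := hAdom.2.1 i j hij h; linarith) hB'dom.1
    (fun i j hij h => by have := hB'dom.2.1 i j hij h; linarith)
    (fun v hv => by
      rw [← hAdatum.multA_pos_iff (hx2.trans hv), ← hB'datum.multA_pos_iff (hx2.trans hv)]
      exact (hmult v hv).1)
    (fun i hi => hx0.1 ((hAdatum.multA_pos_iff hx2).2 ⟨i, hi⟩)) p hp
  obtain ⟨hqb, hqx⟩ := agree_before_and_lt (Nat.sub_le n s) hAdom.2.2.1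
    (fun i j hij h => by have := hAdom.2.2.2.1 i j hij h; linarith) hB'dom.2.2.1
    (fun i j hij h => by have := hB'dom.2.2.2.1 i j hij h; linarith)
    (fun v hv => by
      rw [← multB_pos_iff, ← multB_pos_iff]
      exact (hmult v hv).2)
    (fun j hj => hx0.2 (multB_pos_iff.2 ⟨j, hj⟩)) q hq
  refine not_leB_of_lt (Fin.castLE (Nat.sub_le m s) p) (Fin.castLE (Nat.sub_le n s) q)
    (fun i hi => ?_) (fun j hj => ?_) (hpx.trans_eq hp.symm) (hqx.trans_eq hq.symm) hle
  · exact hpa ⟨i, (Fin.lt_def.1 hi).trans p.isLt⟩ hi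
  · exact hqb ⟨j, (Fin.lt_def.1 hj).trans q.isLt⟩ hj

end GorelikHeidersdorfB
end

section
/- Let m ≥ 1 and n be natural numbers and 0 ≤ s ≤ min(m−1, n). Let A = (a,b) be a dominant stable D_{m|n}-datum, and let B = (a',b') ∈ ℚ^m × ℚ^n be any pair of vectors with B ≤ A. Assume that the truncated pair B' = ((a'_1,…,a'_{m−s}), (b'_1,…,b'_{n−s})) is a dominant D_{m−s|n−s}-datum and that A and B' have equal core. Then B' is stable. (This is Lemma 5.3 of the paper for g = osp(2m|2n) and x of rank s.) -/
/-!
Statement 3: Lemma 5.3 for `g = osp(2m|2n)` and `x` of rank `s`: if `A` is a stable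
dominant `D_{m|n}`-datum, `B ≤ A`, and the truncation `B'` is a dominant
`D_{m-s|n-s}`-datum with the same core as `A`, then `B'` is stable.
-/

namespace GorelikHeidersdorfD

open Finset

/-- The ambient weight space `ℚ^m × ℚ^n`. -/
abbrev V (m n : ℕ) := (Fin m → ℚ) × (Fin n → ℚ)

/-- The basis vector `ε_i` (1-indexed); `0` when `i` is out of range. -/
def eps (m n : ℕ) (i : ℕ) : V m n :=
  (fun j => if (j : ℕ) + 1 = i then 1 else 0, 0)

/-- The basis vector `δ_j` (1-indexed); `0` when `j` is out of range. -/
def delta (m n : ℕ) (j : ℕ) : V m n :=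
  (0, fun k => if (k : ℕ) + 1 = j then 1 else 0)

/-- The sequence `u_1, …, u_{m+n-1}` for `osp(2m|2n)`: for `n ≥ m` it is
`δ_1, …, δ_{n-m+1}, ε_1, δ_{n-m+2}, ε_2, …, ε_{m-1}, δ_n`, and for `m > n` it is
`ε_1, …, ε_{m-n}, δ_1, ε_{m-n+1}, δ_2, …, ε_{m-1}, δ_n`. -/
def uD (m n : ℕ) (t : ℕ) : V m n :=
  if m ≤ n then
    if t ≤ n - m + 1 then delta m n t
    else if (t - (n - m + 1)) % 2 = 1 then eps m n ((t - (n - m + 1) + 1) / 2)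
    else delta m n (n - m + 1 + (t - (n - m + 1)) / 2)
  else
    if t ≤ m - n then eps m n t
    else if (t - (m - n)) % 2 = 1 then delta m n ((t - (m - n) + 1) / 2)
    else eps m n (m - n + (t - (m - n)) / 2)

/-- The simple roots `Σ` of `osp(2m|2n)`, indexed by `1 ≤ t ≤ m+n`:
for `t ≤ m+n-2` the root `u_t - u_{t+1}`, for `t = m+n-1` the root `δ_n - ε_m`,
and for `t = m+n` the root `δ_n + ε_m`. -/
def rootD (m n : ℕ) (t : ℕ) : V m n :=
  if t ≤ m + n - 2 then uD m n t - uD m n (t + 1)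
  else if t = m + n - 1 then delta m n n - eps m n m
  else delta m n n + eps m n m

/-- `B ≤ A` : the difference `A - B` is a linear combination of elements of `Σ`
with non-negative integer coefficients. -/
def leD (m n : ℕ) (B A : V m n) : Prop :=
  ∃ c : ℕ → ℕ, A - B = ∑ t ∈ Finset.Icc 1 (m + n), (c t : ℚ) • rootD m n t

/-- `(a, b)` is a `D_{m|n}`-datum: all entries are integers. -/
def IsDDatum {m n : ℕ} (a : Fin m → ℚ) (b : Fin n → ℚ) : Prop :=
  (∀ i, ∃ k : ℤ, a i = k) ∧ (∀ j, ∃ k : ℤ, b j = k)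

/-- `mult_a(v) = #{i : |a_i| = v}`. -/
def multA {m : ℕ} (a : Fin m → ℚ) (v : ℚ) : ℕ :=
  (univ.filter fun i => |a i| = v).card

/-- `mult_b(v) = #{j : b_j = v}`. -/
def multB {n : ℕ} (b : Fin n → ℚ) (v : ℚ) : ℕ :=
  (univ.filter fun j => b j = v).card

/-- The chain `a_1, …, a_{m-1}, |a_m|`. -/
def achain {m : ℕ} (a : Fin m → ℚ) (i : Fin m) : ℚ :=
  if (i : ℕ) + 1 = m then |a i| else a i

/-- Dominance for a `D_{m|n}`-datum: `a_i ≥ 0` for `i < m`,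
`a_1 ≥ … ≥ a_{m-1} ≥ |a_m|` with equalities forcing the common value `0`,
`b_1 ≥ … ≥ b_n ≥ 0` with equalities forcing `0`, and
`#{j : b_j = 0} ≤ #{i : |a_i| = 0} ≤ #{j : b_j = 0} + 1`. -/
def DDominant {m n : ℕ} (a : Fin m → ℚ) (b : Fin n → ℚ) : Prop :=
  (∀ i : Fin m, (i : ℕ) + 1 < m → 0 ≤ a i) ∧
  (∀ i j : Fin m, i ≤ j → achain a j ≤ achain a i) ∧
  (∀ i j : Fin m, i < j → achain a i = achain a j → achain a i = 0) ∧
  (∀ j : Fin n, 0 ≤ b j) ∧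
  (∀ i j : Fin n, i ≤ j → b j ≤ b i) ∧
  (∀ i j : Fin n, i < j → b i = b j → b i = 0) ∧
  (multB b 0 ≤ multA a 0 ∧ multA a 0 ≤ multB b 0 + 1)

/-- `v` is a `×`-value. -/
def IsCrossValue {m n : ℕ} (a : Fin m → ℚ) (b : Fin n → ℚ) (v : ℚ) : Prop :=
  1 ≤ min (multA a v) (multB b v)

/-- `v` is a `>`-value. -/
def IsGtValue {m n : ℕ} (a : Fin m → ℚ) (b : Fin n → ℚ) (v : ℚ) : Prop :=
  multB b v < multA a v

/-- `v` is a `<`-value. -/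
def IsLtValue {m n : ℕ} (a : Fin m → ℚ) (b : Fin n → ℚ) (v : ℚ) : Prop :=
  multA a v < multB b v

/-- `v` is a core value. -/
def IsCoreValue {m n : ℕ} (a : Fin m → ℚ) (b : Fin n → ℚ) (v : ℚ) : Prop :=
  IsGtValue a b v ∨ IsLtValue a b v

/-- Two data have equal core: the same `>`-values and the same `<`-values. -/
def EqualCore {m n m' n' : ℕ} (a : Fin m → ℚ) (b : Fin n → ℚ)
    (a' : Fin m' → ℚ) (b' : Fin n' → ℚ) : Prop :=
  (∀ v, IsGtValue a b v ↔ IsGtValue a' b' v) ∧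
  (∀ v, IsLtValue a b v ↔ IsLtValue a' b' v)

/-- Stability (D case): every `×`-value is strictly smaller than every nonzero
core value. -/
def DStable {m n : ℕ} (a : Fin m → ℚ) (b : Fin n → ℚ) : Prop :=
  ∀ v w, IsCrossValue a b v → IsCoreValue a b w → w ≠ 0 → v < w

theorem DDominant.abs_eq_achain {m n : ℕ} {a : Fin m → ℚ} {b : Fin n → ℚ}
    (h : DDominant a b) (i : Fin m) : achain a i = |a i| := by
  unfold achain
  split_ifs with hi
  · rfl
  · exact (abs_of_nonneg (h.1 i (by omega))).symm

theorem DDominant.abs_antitone {m n : ℕ} {a : Fin m → ℚ} {b : Fin n → ℚ}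
    (h : DDominant a b) (i j : Fin m) (hij : i ≤ j) : |a j| ≤ |a i| := by
  simpa only [h.abs_eq_achain] using h.2.1 i j hij

theorem DDominant.abs_eq_zero {m n : ℕ} {a : Fin m → ℚ} {b : Fin n → ℚ}
    (h : DDominant a b) (i j : Fin m) (hij : i < j) (he : |a i| = |a j|) : |a i| = 0 := by
  simpa only [h.abs_eq_achain] using h.2.2.1 i j hij (by simpa only [h.abs_eq_achain] using he)

theorem multA_pos_iff {m : ℕ} (a : Fin m → ℚ) (v : ℚ) :
    0 < multA a v ↔ ∃ i, |a i| = v := by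
  simp [multA, Finset.card_pos, Finset.Nonempty]

theorem multB_pos_iff {n : ℕ} (b : Fin n → ℚ) (v : ℚ) :
    0 < multB b v ↔ ∃ j, b j = v := by
  simp [multB, Finset.card_pos, Finset.Nonempty]

theorem isCrossValue_iff {m n : ℕ} (a : Fin m → ℚ) (b : Fin n → ℚ) (v : ℚ) :
    IsCrossValue a b v ↔ 0 < multA a v ∧ 0 < multB b v := by
  simp only [IsCrossValue]
  omega

theorem DDominant.multA_le_one {m n : ℕ} {a : Fin m → ℚ} {b : Fin n → ℚ}
    (h : DDominant a b) {v : ℚ} (hv : v ≠ 0) : multA a v ≤ 1 := by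
  refine Finset.card_le_one.2 fun i hi j hj => ?_
  simp only [mem_filter, mem_univ, true_and] at hi hj
  rcases lt_trichotomy i j with hij | hij | hij
  · exact absurd (hi ▸ h.abs_eq_zero i j hij (hi.trans hj.symm)) hv
  · exact hij
  · exact absurd (hj ▸ h.abs_eq_zero j i hij (hj.trans hi.symm)) hv

theorem DDominant.multB_le_one {m n : ℕ} {a : Fin m → ℚ} {b : Fin n → ℚ}
    (h : DDominant a b) {v : ℚ} (hv : v ≠ 0) : multB b v ≤ 1 := by
  refine Finset.card_le_one.2 fun i hi j hj => ?_
  simp only [mem_filter, mem_univ, true_and] at hi hj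
  rcases lt_trichotomy i j with hij | hij | hij
  · exact absurd (hi ▸ h.2.2.2.2.2.1 i j hij (hi.trans hj.symm)) hv
  · exact hij
  · exact absurd (hj ▸ h.2.2.2.2.2.1 j i hij (hj.trans hi.symm)) hv

/-- Two weakly decreasing sequences with the same values above `v`, strictly decreasing there,
agree until the second one reaches `v`; if `v` is not a value of the first one, that one is
smaller than `v` at this place. -/
theorem eq_before_and_lt_of_same_values {m m' : ℕ} (hm : m' ≤ m) {f : Fin m → ℚ}
    {g : Fin m' → ℚ} {v : ℚ}
    (hf : ∀ i j, i ≤ j → f j ≤ f i) (hg : ∀ i j, i ≤ j → g j ≤ g i)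
    (hf' : ∀ i j, i < j → v < f i → f i ≠ f j) (hg' : ∀ i j, i < j → v ≤ g i → g i ≠ g j)
    (hfg : ∀ x, v < x → ((∃ i, f i = x) ↔ ∃ i, g i = x)) (hv : ∀ i, f i ≠ v)
    (p : Fin m') (hp : g p = v) :
    (∀ q, q < p → f (Fin.castLE hm q) = g q) ∧ f (Fin.castLE hm p) < v := by
  have hlt : ∀ q, q < p → v < g q := fun q hq =>
    lt_of_le_of_ne (hp ▸ hg q p hq.le) fun h =>
      hg' q p hq h.le (h.symm.trans hp.symm)
  have key : ∀ k : ℕ, ∀ q : Fin m', (q : ℕ) = k → q < p → f (Fin.castLE hm q) = g q := by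
    intro k
    induction k using Nat.strong_induction_on with
    | _ k ih =>
      intro q hqk hq
      have h1 : g q ≤ f (Fin.castLE hm q) := by
        obtain ⟨r, hr⟩ := (hfg (g q) (hlt q hq)).2 ⟨q, rfl⟩
        rw [← hr]
        apply hf
        by_contra! hrq
        have hrq' : (r : ℕ) < q := hrq
        have h2 := ih r (by omega) ⟨r, by omega⟩ rfl (lt_trans (Fin.lt_def.2 hrq') hq)
        exact hg' ⟨r, by omega⟩ q (Fin.lt_def.2 hrq') (hlt _ (lt_trans (Fin.lt_def.2 hrq') hq)).le
          (h2.symm.trans hr)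
      refine le_antisymm ?_ h1
      have h3 := (hlt q hq).trans_le h1
      obtain ⟨r, hr⟩ := (hfg _ h3).1 ⟨_, rfl⟩
      rw [← hr]
      apply hg
      by_contra! hrq
      have hrq' : (r : ℕ) < q := hrq
      have h2 := ih r (by omega) r rfl (lt_trans hrq hq)
      exact hf' (Fin.castLE hm r) (Fin.castLE hm q) hrq (h2 ▸ hlt r (lt_trans hrq hq))
        (h2.trans hr)
  refine ⟨fun q hq => key q q rfl hq, ?_⟩
  by_contra! h
  have h3 := lt_of_le_of_ne h (hv _).symm
  obtain ⟨r, hr⟩ := (hfg _ h3).1 ⟨_, rfl⟩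
  have hrp : r < p := by
    by_contra! h4
    have := hg p r h4
    linarith
  exact hf' (Fin.castLE hm r) (Fin.castLE hm p) hrp (key r r rfl hrp ▸ hlt r hrp)
    ((key r r rfl hrp).trans hr)

/-- The sum of the first `I` coordinates along `ε` and the first `J` along `δ`. -/
def initialSum (m n I J : ℕ) : V m n →ₗ[ℚ] ℚ where
  toFun x := (∑ i : Fin m, if (i : ℕ) < I then x.1 i else 0) + ∑ j : Fin n, if (j : ℕ) < J then x.2 j else 0
  map_add' x y := by
    have h (p : Prop) [Decidable p] (u v : ℚ) :
        (if p then u + v else 0) = (if p then u else 0) + if p then v else 0 := by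
      split_ifs <;> simp
    simp only [Prod.fst_add, Prod.snd_add, Pi.add_apply, h, sum_add_distrib]
    ring
  map_smul' c x := by
    simp [mul_add, mul_sum]

theorem initialSum_apply (m n I J : ℕ) (x : V m n) :
    initialSum m n I J x =
      (∑ i : Fin m, if (i : ℕ) < I then x.1 i else 0) + ∑ j : Fin n, if (j : ℕ) < J then x.2 j else 0 := rfl

theorem sum_ite_lt_single {m I : ℕ} (hI : I ≤ m) (k : ℕ) :
    (∑ i : Fin m, if (i : ℕ) < I then (if (i : ℕ) + 1 = k then (1 : ℚ) else 0) else 0) =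
      if 1 ≤ k ∧ k ≤ I then 1 else 0 := by
  split_ifs with h
  · rw [Finset.sum_eq_single ⟨k - 1, by omega⟩]
    · rw [if_pos (by simp only; omega), if_pos (by simp only; omega)]
    · intro i _ hi
      have : (i : ℕ) ≠ k - 1 := fun h' => hi (Fin.ext h')
      rw [if_neg (by omega : ¬ (i : ℕ) + 1 = k), ite_self]
    · simp
  · refine Finset.sum_eq_zero fun i _ => ?_
    split_ifs <;> first | rfl | omega

theorem initialSum_eps {m n I J : ℕ} (hI : I ≤ m) (k : ℕ) :
    initialSum m n I J (eps m n k) = if 1 ≤ k ∧ k ≤ I then 1 else 0 := by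
  rw [initialSum_apply, ← sum_ite_lt_single hI]
  simp [eps]

theorem initialSum_delta {m n I J : ℕ} (hJ : J ≤ n) (k : ℕ) :
    initialSum m n I J (delta m n k) = if 1 ≤ k ∧ k ≤ J then 1 else 0 := by
  rw [initialSum_apply, ← sum_ite_lt_single hJ]
  simp [delta]

/-- The vectors `ε_1, …, ε_I, δ_1, …, δ_J` form an initial segment of `u_1, …, u_{m+n-1}`. -/
def IsInitialSegment (m n I J : ℕ) : Prop :=
  (1 ≤ I ∧ I + 1 ≤ m ∧ J = n + I - m) ∨ (1 ≤ J ∧ J ≤ n ∧ I = m + J - 1 - n)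

theorem initialSum_uD {m n I J t : ℕ} (hm : 1 ≤ m) (h : IsInitialSegment m n I J) (ht : 1 ≤ t)
    (ht' : t ≤ m + n - 1) :
    initialSum m n I J (uD m n t) = if t ≤ I + J then 1 else 0 := by
  have hI : I ≤ m := by unfold IsInitialSegment at h; omega
  have hJ : J ≤ n := by unfold IsInitialSegment at h; omega
  unfold IsInitialSegment at h
  unfold uD
  split_ifs with h1 h2 h3 h4 h4 <;>
    simp only [initialSum_eps hI, initialSum_delta hJ] <;>
    first
    | exact if_pos (by omega)
    | exact if_neg (by omega)

theorem initialSum_rootD_nonneg {m n I J t : ℕ} (hm : 1 ≤ m) (h : IsInitialSegment m n I J)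
    (ht : 1 ≤ t) : 0 ≤ initialSum m n I J (rootD m n t) := by
  have hI : I + 1 ≤ m := by unfold IsInitialSegment at h; omega
  have hJ : J ≤ n := by unfold IsInitialSegment at h; omega
  unfold rootD
  split_ifs with h1 h2
  · rw [map_sub, initialSum_uD hm h ht (by omega), initialSum_uD hm h (by omega) (by omega)]
    split_ifs <;> first | omega | norm_num
  · rw [map_sub, initialSum_eps (by omega), initialSum_delta hJ,
      if_neg (by omega : ¬ (1 ≤ m ∧ m ≤ I))]
    split_ifs <;> norm_num
  · rw [map_add, initialSum_eps (by omega), initialSum_delta hJ,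
      if_neg (by omega : ¬ (1 ≤ m ∧ m ≤ I))]
    split_ifs <;> norm_num

theorem initialSum_nonneg_of_leD {m n I J : ℕ} {A B : V m n} (hm : 1 ≤ m)
    (h : IsInitialSegment m n I J) (hle : leD m n B A) : 0 ≤ initialSum m n I J (A - B) := by
  obtain ⟨c, hc⟩ := hle
  rw [hc, map_sum]
  refine Finset.sum_nonneg fun t ht => ?_
  rw [map_smul, smul_eq_mul]
  exact mul_nonneg (Nat.cast_nonneg _) (initialSum_rootD_nonneg hm h (Finset.mem_Icc.1 ht).1)

theorem sum_ite_lt_nonpos {m I : ℕ} {f : Fin m → ℚ} (h : ∀ i : Fin m, (i : ℕ) < I → f i ≤ 0) :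
    (∑ i : Fin m, if (i : ℕ) < I then f i else 0) ≤ 0 := by
  refine Finset.sum_nonpos fun i _ => ?_
  split_ifs with hi
  · exact h i hi
  · exact le_rfl

theorem sum_ite_lt_neg {m I : ℕ} {f : Fin m → ℚ} (h : ∀ i : Fin m, (i : ℕ) < I → f i ≤ 0)
    (p : Fin m) (hp : (p : ℕ) < I) (hp' : f p < 0) :
    (∑ i : Fin m, if (i : ℕ) < I then f i else 0) < 0 := by
  refine Finset.sum_neg' (fun i _ => ?_) ⟨p, mem_univ p, by rwa [if_pos hp]⟩
  split_ifs with hi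
  · exact h i hi
  · exact le_rfl

/-- **Lemma 5.3** for `osp(2m|2n)` and `x` of rank `s ≤ min(m-1, n)`: if `λ` is
stable dominant, `ν ≤ λ`, the restriction `ν|_{h_x}` (modelled by truncating the
shifted coordinates) is dominant and has the same core as `λ`,
then `ν|_{h_x}` is stable. -/
theorem DStable_of_truncation (m n s : ℕ) (hm : 1 ≤ m) (hs : s ≤ min (m - 1) n)
    (a a' : Fin m → ℚ) (b b' : Fin n → ℚ)
    (hAdatum : IsDDatum a b) (hAdom : DDominant a b) (hAstable : DStable a b)
    (hle : leD m n (a', b') (a, b))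
    (hB'datum : IsDDatum (fun i : Fin (m - s) => a' (Fin.castLE (Nat.sub_le m s) i))
      (fun j : Fin (n - s) => b' (Fin.castLE (Nat.sub_le n s) j)))
    (hB'dom : DDominant (fun i : Fin (m - s) => a' (Fin.castLE (Nat.sub_le m s) i))
      (fun j : Fin (n - s) => b' (Fin.castLE (Nat.sub_le n s) j)))
    (hcore : EqualCore a b (fun i : Fin (m - s) => a' (Fin.castLE (Nat.sub_le m s) i))
      (fun j : Fin (n - s) => b' (Fin.castLE (Nat.sub_le n s) j))) :
    DStable (fun i : Fin (m - s) => a' (Fin.castLE (Nat.sub_le m s) i))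
      (fun j : Fin (n - s) => b' (Fin.castLE (Nat.sub_le n s) j)) := by
  set α : Fin (m - s) → ℚ := fun i => a' (Fin.castLE (Nat.sub_le m s) i) with hα
  set β : Fin (n - s) → ℚ := fun j => b' (Fin.castLE (Nat.sub_le n s) j) with hβ
  intro v₀ w hv₀ hw hw0
  by_contra! hwv₀
  have hwpos : 0 < w := by
    refine lt_of_le_of_ne ?_ hw0.symm
    rcases hw with hw | hw
    · obtain ⟨i, rfl⟩ := (multA_pos_iff α w).1 (lt_of_le_of_lt (Nat.zero_le _) hw)
      exact abs_nonneg _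
    · obtain ⟨j, rfl⟩ := (multB_pos_iff β w).1 (lt_of_le_of_lt (Nat.zero_le _) hw)
      exact hB'dom.2.2.2.1 j
  have hwA : IsCoreValue a b w := hw.imp (hcore.1 w).2 (hcore.2 w).2
  -- the largest cross value of the truncation
  obtain ⟨j₀, hj₀, hmax⟩ : ∃ j₀, IsCrossValue α β (β j₀) ∧
      ∀ x, IsCrossValue α β x → x ≤ β j₀ := by
    classical
    have hmem : ∀ x, IsCrossValue α β x → ∃ j, β j = x ∧ IsCrossValue α β (β j) := by
      intro x hx
      obtain ⟨j, rfl⟩ := (multB_pos_iff β x).1 ((isCrossValue_iff α β x).1 hx).2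
      exact ⟨j, rfl, hx⟩
    obtain ⟨j₁, -, hj₁⟩ := hmem v₀ hv₀
    obtain ⟨j, hj, hj'⟩ := Finset.exists_max_image
      (univ.filter fun j => IsCrossValue α β (β j)) β ⟨j₁, by simpa using hj₁⟩
    refine ⟨j, (mem_filter.1 hj).2, fun x hx => ?_⟩
    obtain ⟨k, rfl, hk⟩ := hmem x hx
    exact hj' k (by simpa using hk)
  obtain ⟨v, hv⟩ : ∃ v, β j₀ = v := ⟨_, rfl⟩
  rw [hv] at hj₀ hmax
  have hwv : w ≤ v := hwv₀.trans (hmax v₀ hv₀)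
  have hvpos : 0 < v := hwpos.trans_le hwv
  have hA : ∀ x, v ≤ x → ¬ (0 < multA a x ∧ 0 < multB b x) := fun x hx hx' =>
    absurd (hAstable x w ((isCrossValue_iff a b x).2 hx') hwA hw0) (not_lt.2 (hwv.trans hx))
  have hB : ∀ x, v < x → ¬ (0 < multA α x ∧ 0 < multB β x) := fun x hx hx' =>
    absurd (hmax x ((isCrossValue_iff α β x).2 hx')) (not_le.2 hx)
  have hvcross := (isCrossValue_iff α β v).1 hj₀
  have hvA := hB'dom.multA_le_one hvpos.ne'
  have hvB := hB'dom.multB_le_one hvpos.ne'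
  obtain ⟨i₀, hi₀⟩ := (multA_pos_iff α v).1 hvcross.1
  obtain ⟨ha_eq, ha_lt⟩ := eq_before_and_lt_of_same_values (Nat.sub_le m s)
    (f := fun i => |a i|) (g := fun i => |α i|) (v := v) hAdom.abs_antitone hB'dom.abs_antitone
    (fun i j hij hi he => (hvpos.trans hi).ne' (hAdom.abs_eq_zero i j hij he))
    (fun i j hij hi he => (hvpos.trans_le hi).ne' (hB'dom.abs_eq_zero i j hij he))
    (fun x hx => by
      have h1 := hA x hx.le
      have h2 := hB x hx
      have h3 := hcore.1 x
      unfold IsGtValue at h3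
      rw [← multA_pos_iff, ← multA_pos_iff]
      omega)
    (fun i hi => by
      have h0 := (multA_pos_iff a v).2 ⟨i, hi⟩
      have h1 := hA v le_rfl
      have h3 := hcore.1 v
      unfold IsGtValue at h3
      omega)
    i₀ hi₀
  obtain ⟨hb_eq, hb_lt⟩ := eq_before_and_lt_of_same_values (Nat.sub_le n s)
    (f := b) (g := β) (v := v) hAdom.2.2.2.2.1 hB'dom.2.2.2.2.1
    (fun i j hij hi he => (hvpos.trans hi).ne' (hAdom.2.2.2.2.2.1 i j hij he))
    (fun i j hij hi he => (hvpos.trans_le hi).ne' (hB'dom.2.2.2.2.2.1 i j hij he))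
    (fun x hx => by
      have h1 := hA x hx.le
      have h2 := hB x hx
      have h3 := hcore.2 x
      unfold IsLtValue at h3
      rw [← multB_pos_iff, ← multB_pos_iff]
      omega)
    (fun j hj => by
      have h0 := (multB_pos_iff b v).2 ⟨j, hj⟩
      have h1 := hA v le_rfl
      have h3 := hcore.2 v
      unfold IsLtValue at h3
      omega)
    j₀ hv
  have hi₀m := i₀.isLt
  have hj₀n := j₀.isLt
  have ha_le : ∀ i : Fin m, (i : ℕ) < i₀ → (a - a') i ≤ 0 := by
    intro i hi
    have h1 := ha_eq ⟨i, by omega⟩ (Fin.lt_def.2 hi)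
    have h2 := hB'dom.1 ⟨i, by omega⟩ (by simp only; omega)
    have h3 : |a i| = a' i := h1.trans (abs_of_nonneg h2)
    have h4 := le_abs_self (a i)
    rw [Pi.sub_apply]
    linarith
  have hb_le : ∀ j : Fin n, (j : ℕ) < j₀ → (b - b') j ≤ 0 := by
    intro j hj
    have h1 : b j = b' j := hb_eq ⟨j, by omega⟩ (Fin.lt_def.2 hj)
    rw [Pi.sub_apply, h1, sub_self]
  rcases le_or_gt ((i₀ : ℕ) + 1 + n) (j₀ + m) with hfirst | hfirst
  · have hnn := initialSum_nonneg_of_leD (I := i₀ + 1) (J := n + (i₀ + 1) - m) hm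
      (Or.inl ⟨by omega, by omega, rfl⟩) hle
    have hneg : (a - a') (Fin.castLE (Nat.sub_le m s) i₀) < 0 := by
      have h2 := hB'dom.1 i₀ (by omega)
      rw [abs_of_nonneg h2] at hi₀
      have h3 : a' (Fin.castLE (Nat.sub_le m s) i₀) = v := hi₀
      have h4 := le_abs_self (a (Fin.castLE (Nat.sub_le m s) i₀))
      rw [Pi.sub_apply, h3]
      linarith
    have h1 := sum_ite_lt_neg (I := i₀ + 1) (f := a - a') (fun i hi => by
      rcases Nat.lt_succ_iff_lt_or_eq.1 hi with hi | hi
      · exact ha_le i hi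
      · have : i = Fin.castLE (Nat.sub_le m s) i₀ := Fin.ext hi
        exact this ▸ hneg.le) _ (by simp) hneg
    have h2 := sum_ite_lt_nonpos (I := n + (i₀ + 1) - m) (f := b - b')
      (fun j hj => hb_le j (by omega))
    rw [initialSum_apply] at hnn
    exact absurd hnn (not_le.2 (add_neg_of_neg_of_nonpos h1 h2))
  · have hnn := initialSum_nonneg_of_leD (I := m + (j₀ + 1) - 1 - n) (J := j₀ + 1) hm
      (Or.inr ⟨by omega, by omega, rfl⟩) hle
    have hneg : (b - b') (Fin.castLE (Nat.sub_le n s) j₀) < 0 := by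
      have h3 : b' (Fin.castLE (Nat.sub_le n s) j₀) = v := hv
      rw [Pi.sub_apply, h3]
      linarith
    have h1 := sum_ite_lt_neg (I := j₀ + 1) (f := b - b') (fun j hj => by
      rcases Nat.lt_succ_iff_lt_or_eq.1 hj with hj | hj
      · exact hb_le j hj
      · have : j = Fin.castLE (Nat.sub_le n s) j₀ := Fin.ext hj
        exact this ▸ hneg.le) _ (by simp) hneg
    have h2 := sum_ite_lt_nonpos (I := m + (j₀ + 1) - 1 - n) (f := a - a')
      (fun i hi => ha_le i (by omega))
    rw [initialSum_apply] at hnn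
    exact absurd hnn (not_le.2 (add_neg_of_nonpos_of_neg h2 h1))

end GorelikHeidersdorfD
end
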